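/- arXiv:math/0103063 — 12 statements merged into one kernel-verified Lean document; each statement's English description precedes it below -/
import Mathlib

section
/- Let R > 0 and let f, A : ℂ → ℂ be complex-analytic on the open ball B(0,2R), with f(0) = 0, f′(0) = 1 and A(0) = 1. If f(x−y)·f(y−x) = A(x)·f(y)·f(x−y) + A(y)·f(x)·f(y−x) for all x, y ∈ B(0,R), then for all x ∈ B(0,R): A(x)·f(x) + A′(0)·f(−x)·f(x) + f(−x)·f′(x) = 0. (In particular A is completely determined on B(0,R), at points where f(x) ≠ 0, by f and the number a₁ := A′(0).) -/
open Metric Complex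

/-- If `f, A` are analytic on `B(0,2R)` with `f(0)=0`, `f′(0)=1`, `A(0)=1`
and satisfy the functional equation on `B(0,R)`, then
`A(x)·f(x) + A′(0)·f(−x)·f(x) + f(−x)·f′(x) = 0` on `B(0,R)`. -/
theorem stmt_1 (R : ℝ) (hR : 0 < R) (f A : ℂ → ℂ)
    (hf : AnalyticOnNhd ℂ f (ball (0 : ℂ) (2 * R)))
    (hA : AnalyticOnNhd ℂ A (ball (0 : ℂ) (2 * R)))
    (hf0 : f 0 = 0) (hf'0 : deriv f 0 = 1) (hA0 : A 0 = 1)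
    (hFE : ∀ x ∈ ball (0 : ℂ) R, ∀ y ∈ ball (0 : ℂ) R,
      f (x - y) * f (y - x) = A x * f y * f (x - y) + A y * f x * f (y - x)) :
    ∀ x ∈ ball (0 : ℂ) R,
      A x * f x + deriv A 0 * f (-x) * f x + f (-x) * deriv f x = 0 := by
  intro x hx
  have hd : ∀ z ∈ ball (0 : ℂ) R, HasDerivAt f (deriv f z) z := fun z hz =>
    (hf z (ball_subset_ball (by linarith) hz)).differentiableAt.hasDerivAt
  have h0 : (0 : ℂ) ∈ ball (0 : ℂ) R := mem_ball_self hR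
  have hnx : -x ∈ ball (0 : ℂ) R := by simpa using hx
  have hdA : HasDerivAt A (deriv A 0) 0 :=
    (hA 0 (mem_ball_self (by linarith))).differentiableAt.hasDerivAt
  have hd0 : HasDerivAt f 1 0 := hf'0 ▸ hd 0 h0
  have hsub : HasDerivAt (fun y => f (x - y)) (-deriv f x) 0 := by
    apply HasDerivAt.comp_const_sub
    simpa using hd x hx
  have hsub' : HasDerivAt (fun y => f (y - x)) (deriv f (-x)) 0 := by
    apply HasDerivAt.comp_sub_const
    simpa using hd (-x) hnx
  have hL := hsub.fun_mul hsub'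
  have hRt := ((hd0.const_mul (A x)).fun_mul hsub).fun_add ((hdA.mul_const (f x)).fun_mul hsub')
  have heq : (fun y => f (x - y) * f (y - x)) =ᶠ[nhds 0]
      fun y => A x * f y * f (x - y) + A y * f x * f (y - x) := by
    filter_upwards [isOpen_ball.mem_nhds h0] with y hy using hFE x hx y hy
  have key := hL.unique (hRt.congr_of_eventuallyEq heq)
  simp only [sub_zero, zero_sub, hf0, hA0] at key
  linear_combination -key
end

section
/- Let R > 0 and let f, A : ℂ → ℂ be complex-analytic on the open ball B(0,2R), with f(0) = 0, f′(0) = 1 and A(0) = 1, and set a₁ := A′(0). If f(x−y)·f(y−x) = A(x)·f(y)·f(x−y) + A(y)·f(x)·f(y−x) for all x, y ∈ B(0,R), then for all x, y ∈ B(0,R) the following identity involving only f holds: f(x)·f(y)·f(x−y)·f(y−x) + (a₁·f(x)·f(−x) + f′(x)·f(−x))·f(x−y)·f(y)² + (a₁·f(y)·f(−y) + f′(y)·f(−y))·f(y−x)·f(x)² = 0. -/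
open Metric Complex

/-- Differentiating the functional equation in `y` at `0` expresses `A x * f x` through `f`. -/
theorem mul_eq_of_functional_equation {R : ℝ} (hR : 0 < R) {f A : ℂ → ℂ} {x : ℂ}
    (hfx : DifferentiableAt ℂ f x) (hfnx : DifferentiableAt ℂ f (-x))
    (hdf : DifferentiableAt ℂ f 0) (hdA : DifferentiableAt ℂ A 0)
    (hf0 : f 0 = 0) (hf'0 : deriv f 0 = 1) (hA0 : A 0 = 1)
    (hFE : ∀ y ∈ ball (0 : ℂ) R,
      f (x - y) * f (y - x) = A x * f y * f (x - y) + A y * f x * f (y - x)) :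
    A x * f x = -(deriv A 0 * f x * f (-x) + deriv f x * f (-x)) := by
  have h0 : HasDerivAt f 1 0 := hf'0 ▸ hdf.hasDerivAt
  have h1 : HasDerivAt (fun y => f (x - y)) (-deriv f x) 0 := by
    have h : HasDerivAt f (deriv f x) (x - 0) := by simpa using hfx.hasDerivAt
    exact h.comp_const_sub x 0
  have h2 : HasDerivAt (fun y => f (y - x)) (deriv f (-x)) 0 := by
    have h : HasDerivAt f (deriv f (-x)) (0 - x) := by simpa using hfnx.hasDerivAt
    exact h.comp_sub_const 0 x
  have hL := h1.fun_mul h2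
  have hr := ((h0.const_mul (A x)).fun_mul h1).fun_add
    ((hdA.hasDerivAt.mul_const (f x)).fun_mul h2)
  have hEq : (fun y => f (x - y) * f (y - x)) =ᶠ[nhds 0]
      fun y => A x * f y * f (x - y) + A y * f x * f (y - x) := by
    filter_upwards [ball_mem_nhds (0 : ℂ) hR] with y hy using hFE y hy
  have key := hL.unique (hr.congr_of_eventuallyEq hEq)
  simp only [sub_zero, zero_sub, hf0, hA0] at key
  linear_combination -key

/-- If `f, A` are analytic on `B(0,2R)` with `f(0)=0`, `f′(0)=1`, `A(0)=1`
and satisfy the functional equation on `B(0,R)`, then with `a₁ := A′(0)` the identity FE*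
involving only `f` holds on `B(0,R) × B(0,R)`. -/
theorem stmt_2 (R : ℝ) (hR : 0 < R) (f A : ℂ → ℂ)
    (hf : AnalyticOnNhd ℂ f (ball (0 : ℂ) (2 * R)))
    (hA : AnalyticOnNhd ℂ A (ball (0 : ℂ) (2 * R)))
    (hf0 : f 0 = 0) (hf'0 : deriv f 0 = 1) (hA0 : A 0 = 1)
    (hFE : ∀ x ∈ ball (0 : ℂ) R, ∀ y ∈ ball (0 : ℂ) R,
      f (x - y) * f (y - x) = A x * f y * f (x - y) + A y * f x * f (y - x)) :
    ∀ x ∈ ball (0 : ℂ) R, ∀ y ∈ ball (0 : ℂ) R,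
      f x * f y * f (x - y) * f (y - x)
        + (deriv A 0 * f x * f (-x) + deriv f x * f (-x)) * f (x - y) * (f y) ^ 2
        + (deriv A 0 * f y * f (-y) + deriv f y * f (-y)) * f (y - x) * (f x) ^ 2 = 0 := by
  have hrel : ∀ x ∈ ball (0 : ℂ) R,
      A x * f x = -(deriv A 0 * f x * f (-x) + deriv f x * f (-x)) := by
    intro x hx
    have hsub : ball (0 : ℂ) R ⊆ ball 0 (2 * R) := ball_subset_ball (by linarith)
    have h0 : (0 : ℂ) ∈ ball (0 : ℂ) (2 * R) := hsub (mem_ball_self hR)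
    have hnx : -x ∈ ball (0 : ℂ) R := by simpa using hx
    exact mul_eq_of_functional_equation hR (hf x (hsub hx)).differentiableAt
      (hf _ (hsub hnx)).differentiableAt (hf 0 h0).differentiableAt
      (hA 0 h0).differentiableAt hf0 hf'0 hA0 (hFE x hx)
  intro x hx y hy
  linear_combination f x * f y * hFE x hx y hy + f (x - y) * f y ^ 2 * hrel x hx
    + f (y - x) * f x ^ 2 * hrel y hy
end

section
/- Let R > 0 and let f : ℂ → ℂ be complex-analytic on the open ball B(0,2R), with f(0) = 0, f′(0) = 1, f″(0) = 0, and let a₁ ∈ ℂ. Suppose that for all x, y ∈ B(0,R): f(x)·f(y)·f(x−y)·f(y−x) + (a₁·f(x)·f(−x) + f′(x)·f(−x))·f(x−y)·f(y)² + (a₁·f(y)·f(−y) + f′(y)·f(−y))·f(y−x)·f(x)² = 0. Then for all x ∈ B(0,R): f(x) + a₁·(f(x)·f′(−x) + f′(x)·f(−x))·f(x) + f′(x)·f′(−x)·f(x) + 2·f(−x)·f′(x)² − f(−x)·f″(x)·f(x) = 0 (this is the differential equation DE-1 multiplied through by f(x)). -/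
open Metric Complex

/-- An analytic function vanishing at `0` factors as `z * u z` with `u` analytic, and the first
two derivatives of `f` at `0` determine `u` to first order. -/
lemma AnalyticAt.exists_eq_mul_of_apply_zero_eq_zero {f : ℂ → ℂ} (hf : AnalyticAt ℂ f 0)
    (hf0 : f 0 = 0) :
    ∃ u : ℂ → ℂ, AnalyticAt ℂ u 0 ∧ (∀ z, f z = z * u z) ∧ u 0 = deriv f 0 ∧
      2 * deriv u 0 = deriv (deriv f) 0 := by
  obtain ⟨p, hp⟩ := hf
  have hu : AnalyticAt ℂ (dslope f 0) 0 := hp.has_fpower_series_dslope_fslope.analyticAt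
  have hfu : ∀ z, f z = z * dslope f 0 z := fun z ↦ by
    simpa [hf0] using (sub_smul_dslope f 0 z).symm
  refine ⟨dslope f 0, hu, hfu, dslope_same f 0, ?_⟩
  have hd : deriv f =ᶠ[nhds 0] fun z ↦ dslope f 0 z + z * deriv (dslope f 0) z := by
    filter_upwards [hu.eventually_analyticAt] with z hz
    have h := (hasDerivAt_id' z).mul hz.differentiableAt.hasDerivAt
    rw [one_mul] at h
    exact (h.congr_of_eventuallyEq (Filter.Eventually.of_forall hfu)).deriv
  have h := hu.differentiableAt.hasDerivAt.add
    ((hasDerivAt_id' (0 : ℂ)).mul hu.deriv.differentiableAt.hasDerivAt)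
  rw [(h.congr_of_eventuallyEq hd).deriv]
  ring

/-- If a function differentiable at `0` vanishes after multiplication by the variable near `0`,
then its derivative at `0` vanishes. -/
lemma HasDerivAt.eq_zero_of_eventually_mul_eq_zero {k : ℂ → ℂ} {k' : ℂ} (hk : HasDerivAt k k' 0)
    (h : ∀ᶠ z in nhds 0, z * k z = 0) : k' = 0 := by
  have hne : k =ᶠ[nhdsWithin 0 {0}ᶜ] fun _ ↦ 0 := by
    filter_upwards [h.filter_mono nhdsWithin_le_nhds, self_mem_nhdsWithin] with z hz hz0
    exact (mul_eq_zero.mp hz).resolve_left hz0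
  have hnhds : k =ᶠ[nhds 0] fun _ ↦ 0 :=
    (hk.continuousAt.eventuallyEq_nhds_iff_eventuallyEq_nhdsNE continuousAt_const).mp hne
  exact hk.unique ((hasDerivAt_const 0 0).congr_of_eventuallyEq hnhds)

/-- Second-order expansion of the functional equation on the diagonal. -/
lemma mul_eq_zero_of_functional_equation {f g : ℂ → ℂ} {x f' g' : ℂ}
    (hf : AnalyticAt ℂ f 0) (hf0 : f 0 = 0) (hf'0 : deriv f 0 = 1) (hf''0 : deriv (deriv f) 0 = 0)
    (hfx : HasDerivAt f f' x) (hgx : HasDerivAt g g' x)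
    (hFE : ∀ᶠ z in nhds (0 : ℂ), f x * f (x + z) * f (-z) * f z + g x * f (-z) * f (x + z) ^ 2
      + g (x + z) * f z * f x ^ 2 = 0) :
    f x * (g' * f x - f x - 2 * g x * f') = 0 := by
  obtain ⟨u, hu, hfu, hu0, hu1⟩ := hf.exists_eq_mul_of_apply_zero_eq_zero hf0
  rw [hf'0] at hu0
  have hu' : HasDerivAt u 0 0 := by
    have h := hu.differentiableAt.hasDerivAt
    rwa [show deriv u 0 = 0 by simpa [hf''0] using hu1] at h
  have hun : HasDerivAt (fun z ↦ u (-z)) 0 0 := by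
    have h := HasDerivAt.comp (0 : ℂ) (h₂ := u) (h₂' := 0) (by simpa using hu')
      (hasDerivAt_neg (0 : ℂ))
    simpa [Function.comp_def] using h
  have hfs : HasDerivAt (fun z ↦ f (x + z)) f' 0 :=
    HasDerivAt.comp_const_add x 0 (by simpa using hfx)
  have hgs : HasDerivAt (fun z ↦ g (x + z)) g' 0 :=
    HasDerivAt.comp_const_add x 0 (by simpa using hgx)
  have hk := (((((hasDerivAt_id' (0 : ℂ)).mul hfs).mul (hun.mul hu')).const_mul (-f x)).sub
    ((hun.mul (hfs.pow 2)).const_mul (g x))).add ((hgs.mul hu').mul_const (f x ^ 2))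
  have h := hk.eq_zero_of_eventually_mul_eq_zero (by
    filter_upwards [hFE] with z hz
    rw [hfu z, hfu (-z)] at hz
    simp only [Pi.add_apply, Pi.sub_apply, Pi.mul_apply, Pi.pow_apply]
    linear_combination hz)
  simp [hu0] at h
  linear_combination h

/-- If `f` is analytic on `B(0,2R)` with `f(0)=0`, `f′(0)=1`, `f″(0)=0` and
satisfies the identity FE* on `B(0,R) × B(0,R)`, then the differential equation DE-1
(multiplied through by `f(x)`) holds on `B(0,R)`. -/
theorem stmt_3 (R : ℝ) (hR : 0 < R) (f : ℂ → ℂ) (a₁ : ℂ)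
    (hf : AnalyticOnNhd ℂ f (ball (0 : ℂ) (2 * R)))
    (hf0 : f 0 = 0) (hf'0 : deriv f 0 = 1) (hf''0 : deriv (deriv f) 0 = 0)
    (hFE : ∀ x ∈ ball (0 : ℂ) R, ∀ y ∈ ball (0 : ℂ) R,
      f x * f y * f (x - y) * f (y - x)
        + (a₁ * f x * f (-x) + deriv f x * f (-x)) * f (x - y) * (f y) ^ 2
        + (a₁ * f y * f (-y) + deriv f y * f (-y)) * f (y - x) * (f x) ^ 2 = 0) :
    ∀ x ∈ ball (0 : ℂ) R,
      f x + a₁ * (f x * deriv f (-x) + deriv f x * f (-x)) * f x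
        + deriv f x * deriv f (-x) * f x
        + 2 * f (-x) * (deriv f x) ^ 2
        - f (-x) * deriv (deriv f) x * f x = 0 := by
  have hfR : AnalyticOnNhd ℂ f (ball 0 R) := hf.mono (ball_subset_ball (by linarith))
  have hneg : ∀ x ∈ ball (0 : ℂ) R, -x ∈ ball (0 : ℂ) R := fun x hx ↦ by simpa using hx
  have hfn : AnalyticOnNhd ℂ (fun x ↦ f (-x)) (ball 0 R) :=
    hfR.comp analyticOnNhd_id.neg hneg
  have hdfn : AnalyticOnNhd ℂ (fun x ↦ deriv f (-x)) (ball 0 R) :=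
    hfR.deriv.comp analyticOnNhd_id.neg hneg
  have h0 : (0 : ℂ) ∈ ball (0 : ℂ) R := mem_ball_self hR
  have hDE : AnalyticOnNhd ℂ (fun x ↦ f x
        + a₁ * (f x * deriv f (-x) + deriv f x * f (-x)) * f x
        + deriv f x * deriv f (-x) * f x
        + 2 * f (-x) * (deriv f x) ^ 2
        - f (-x) * deriv (deriv f) x * f x) (ball 0 R) :=
    (((hfR.add ((analyticOnNhd_const.mul ((hfR.mul hdfn).add (hfR.deriv.mul hfn))).mul hfR)).add
      ((hfR.deriv.mul hdfn).mul hfR)).add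
      ((analyticOnNhd_const.mul hfn).mul (hfR.deriv.pow 2))).sub ((hfn.mul hfR.deriv.deriv).mul hfR)
  refine (hfR.eq_zero_or_eq_zero_of_mul_eq_zero hDE (fun x hx ↦ ?_)
    (convex_ball 0 R).isPreconnected).resolve_left fun h ↦ ?_
  · have hfx := (hfR x hx).differentiableAt.hasDerivAt
    have hdfx := (hfR.deriv x hx).differentiableAt.hasDerivAt
    have hfnx : HasDerivAt (fun y ↦ f (-y)) (-deriv f (-x)) x := by
      simpa [Function.comp_def] using
        (hfR (-x) (hneg x hx)).differentiableAt.hasDerivAt.scomp x (hasDerivAt_neg x)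
    have key := mul_eq_zero_of_functional_equation (hfR 0 h0) hf0 hf'0 hf''0 hfx
      (((hfx.const_mul a₁).mul hfnx).add (hdfx.mul hfnx)) (by
        have hc : ContinuousAt (fun z : ℂ ↦ x + z) 0 := by fun_prop
        filter_upwards [hc.eventually_mem (isOpen_ball.mem_nhds (by rwa [add_zero]))] with z hz
        simpa using hFE x hx (x + z) hz)
    simp only [Pi.add_apply, Pi.mul_apply] at key
    linear_combination -key
  · have hev : f =ᶠ[nhds 0] fun _ ↦ 0 := by
      filter_upwards [isOpen_ball.mem_nhds h0] with z hz using h z hz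
    simp [hev.deriv_eq] at hf'0
end

section
/- Let R > 0 and let f : ℂ → ℂ be complex-analytic on the open ball B(0,2R), with f(0) = 0, f′(0) = 1, f″(0) = 0, and let a₁ ∈ ℂ. Suppose that for all x, y ∈ B(0,R): f(x)·f(y)·f(x−y)·f(y−x) + (a₁·f(x)·f(−x) + f′(x)·f(−x))·f(x−y)·f(y)² + (a₁·f(y)·f(−y) + f′(y)·f(−y))·f(y−x)·f(x)² = 0. Then for all x ∈ B(0,R): f‴(0)·f(x)²·f(−x) + 2·a₁·(f(x)·f′(−x) + f′(x)·f(−x))·f(x) + 2·f′(x)·f′(−x)·f(x) + 2·f(−x)·f′(x)² − f(−x)·f″(x)·f(x) = 0 (this is the differential equation DE-2, with 6f₃ = f‴(0), multiplied through by f(x)). -/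
open Metric Complex

open Filter Topology

/-- Splitting off the constant term of an analytic function, with the first two derivatives of the
quotient at the base point. -/
lemma AnalyticAt.exists_eq_add_mul {f : ℂ → ℂ} {a : ℂ} (hf : AnalyticAt ℂ f a) :
    ∃ g : ℂ → ℂ, AnalyticAt ℂ g a ∧ (∀ z, f z = f a + (z - a) * g z) ∧ g a = deriv f a ∧
      deriv g a = deriv (deriv f) a / 2 ∧
      deriv (deriv g) a = deriv (deriv (deriv f)) a / 3 := by
  obtain ⟨p, hp⟩ := hf
  have hg : AnalyticAt ℂ (dslope f a) a := ⟨_, hp.has_fpower_series_dslope_fslope⟩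
  set g := dslope f a with hgdef
  have hfg : ∀ z, f z = f a + (z - a) * g z := by
    intro z
    have := sub_smul_dslope f a z
    rw [smul_eq_mul] at this
    rw [hgdef, this]
    ring
  have hd1 : deriv f =ᶠ[𝓝 a] fun z => g z + (z - a) * deriv g z := by
    filter_upwards [hg.eventually_analyticAt] with z hz
    have h := (((hasDerivAt_id z).sub_const a).mul hz.differentiableAt.hasDerivAt).const_add (f a)
    have hfun : f = fun z => f a + (z - a) * g z := funext hfg
    have h' : HasDerivAt f (1 * g z + (z - a) * deriv g z) z := by
      rw [hfun]
      simpa using h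
    rw [h'.deriv, one_mul]
  have hd2 : deriv (deriv f) =ᶠ[𝓝 a] fun z => 2 * deriv g z + (z - a) * deriv (deriv g) z := by
    filter_upwards [hd1.eventuallyEq_nhds, hg.eventually_analyticAt] with z hz hgz
    rw [hz.deriv_eq]
    have h := hgz.differentiableAt.hasDerivAt.add
      (((hasDerivAt_id z).sub_const a).mul hgz.deriv.differentiableAt.hasDerivAt)
    refine (h.congr_deriv ?_).deriv
    simp only [id]
    ring
  have hd3 : deriv (deriv (deriv f)) a = 3 * deriv (deriv g) a := by
    rw [hd2.deriv_eq]
    have h := (hg.deriv.differentiableAt.hasDerivAt.const_mul 2).add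
      (((hasDerivAt_id a).sub_const a).mul hg.deriv.deriv.differentiableAt.hasDerivAt)
    refine (h.congr_deriv ?_).deriv
    simp only [id]
    ring
  refine ⟨g, hg, hfg, dslope_same f a, ?_, ?_⟩
  · rw [hd2.eq_of_nhds]
    ring
  · rw [hd3]
    ring

/-- Second-order Taylor expansion with analytic remainder. -/
lemma AnalyticAt.exists_eq_taylor_two {f : ℂ → ℂ} {a : ℂ} (hf : AnalyticAt ℂ f a) :
    ∃ r : ℂ → ℂ, AnalyticAt ℂ r a ∧
      (∀ z, f z = f a + deriv f a * (z - a) + (z - a) ^ 2 * r z) ∧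
      r a = deriv (deriv f) a / 2 ∧ deriv r a = deriv (deriv (deriv f)) a / 6 := by
  obtain ⟨g, hg, hfg, hg0, hg1, hg2⟩ := hf.exists_eq_add_mul
  obtain ⟨r, hr, hgr, hr0, hr1, -⟩ := hg.exists_eq_add_mul
  refine ⟨r, hr, fun z => ?_, by rw [hr0, hg1], by rw [hr1, hg2]; ring⟩
  rw [hfg z, hgr z, hg0]
  ring

/-- If `f` is analytic on `B(0,2R)` with `f(0)=0`, `f′(0)=1`, `f″(0)=0` and
satisfies the identity FE* on `B(0,R) × B(0,R)`, then the differential equation DE-2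
(with `6f₃ = f‴(0)`, multiplied through by `f(x)`) holds on `B(0,R)`. -/
theorem stmt_4 (R : ℝ) (hR : 0 < R) (f : ℂ → ℂ) (a₁ : ℂ)
    (hf : AnalyticOnNhd ℂ f (ball (0 : ℂ) (2 * R)))
    (hf0 : f 0 = 0) (hf'0 : deriv f 0 = 1) (hf''0 : deriv (deriv f) 0 = 0)
    (hFE : ∀ x ∈ ball (0 : ℂ) R, ∀ y ∈ ball (0 : ℂ) R,
      f x * f y * f (x - y) * f (y - x)
        + (a₁ * f x * f (-x) + deriv f x * f (-x)) * f (x - y) * (f y) ^ 2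
        + (a₁ * f y * f (-y) + deriv f y * f (-y)) * f (y - x) * (f x) ^ 2 = 0) :
    ∀ x ∈ ball (0 : ℂ) R,
      deriv (deriv (deriv f)) 0 * (f x) ^ 2 * f (-x)
        + 2 * a₁ * (f x * deriv f (-x) + deriv f x * f (-x)) * f x
        + 2 * deriv f x * deriv f (-x) * f x
        + 2 * f (-x) * (deriv f x) ^ 2
        - f (-x) * deriv (deriv f) x * f x = 0 := by
  intro x hx
  have hsub : ball (0 : ℂ) R ⊆ ball (0 : ℂ) (2 * R) := ball_subset_ball (by linarith)
  have hx' : -x ∈ ball (0 : ℂ) R := by simpa using hx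
  have h0 : AnalyticAt ℂ f 0 := hf 0 (mem_ball_self (by linarith))
  obtain ⟨r₁, hr₁, hfr₁, hr₁0, -⟩ := (hf x (hsub hx)).exists_eq_taylor_two
  obtain ⟨r₂, hr₂, hfr₂, -, -⟩ := (hf (-x) (hsub hx')).exists_eq_taylor_two
  obtain ⟨s, hs, hfs, hs0, -⟩ := h0.deriv.exists_eq_taylor_two
  obtain ⟨t, ht, hft, ht0, ht1⟩ := h0.exists_eq_taylor_two
  obtain ⟨q, hq, htq, hq0, -, -⟩ := ht.exists_eq_add_mul
  have hfq : ∀ y, f y = y * (1 + y ^ 2 * q y) := by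
    intro y
    rw [hft y, htq y, ht0, hf0, hf'0, hf''0]
    ring
  have hfs' : ∀ y, deriv f y = 1 + y ^ 2 * s y := by
    intro y
    rw [hfs y, hf'0, hf''0]
    ring
  have hA : ∀ y, f (x - y) = f x + y * (-deriv f x + y * r₁ (x - y)) := by
    intro y
    rw [hfr₁ (x - y)]
    ring
  have hB : ∀ y, f (y - x) = f (-x) + y * (deriv f (-x) + y * r₂ (y - x)) := by
    intro y
    rw [hfr₂ (y - x)]
    ring
  -- The left-hand side of the functional equation is `y ^ 3 * K y`.
  let K : ℂ → ℂ := fun y =>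
    f x * f (-x) * r₁ (x - y)
      + q y * f x * (f x + y * (-deriv f x + y * r₁ (x - y)))
        * (f (-x) + y * (deriv f (-x) + y * r₂ (y - x)))
      + f x * (-deriv f x + y * r₁ (x - y)) * (deriv f (-x) + y * r₂ (y - x))
      + (a₁ * f x * f (-x) + deriv f x * f (-x)) * (-deriv f x + y * r₁ (x - y))
      + y * (a₁ * f x * f (-x) + deriv f x * f (-x))
        * (f x + y * (-deriv f x + y * r₁ (x - y))) * q y * (2 + y ^ 2 * q y)
      - a₁ * f x ^ 2 * (deriv f (-x) + y * r₂ (y - x))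
      - f x ^ 2 * (f (-x) + y * (deriv f (-x) + y * r₂ (y - x)))
        * (s y + a₁ * y * q y
          + q (-y) * (1 + a₁ * y * (1 + y ^ 2 * q y) + y ^ 2 * s y))
  have hKzero : ∀ᶠ y in 𝓝[≠] (0 : ℂ), K y = 0 := by
    filter_upwards [self_mem_nhdsWithin, nhdsWithin_le_nhds (ball_mem_nhds (0 : ℂ) hR)]
      with y hy hyR
    have h := hFE x hx y hyR
    rw [hA, hB, hfs' y, hfq y, hfq (-y)] at h
    refine (mul_eq_zero.mp (?_ : y ^ 3 * K y = 0)).resolve_left (pow_ne_zero 3 hy)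
    simp only [K]
    linear_combination h
  have hKcont : ContinuousAt K 0 := by
    have c₁ : ContinuousAt (fun y => r₁ (x - y)) 0 :=
      ContinuousAt.comp (g := r₁) (by simpa using hr₁.continuousAt) (by fun_prop)
    have c₂ : ContinuousAt (fun y => r₂ (y - x)) 0 :=
      ContinuousAt.comp (g := r₂) (by simpa using hr₂.continuousAt) (by fun_prop)
    have c₃ : ContinuousAt (fun y => q (-y)) 0 :=
      ContinuousAt.comp (g := q) (by simpa using hq.continuousAt) (by fun_prop)
    have c₄ := hq.continuousAt
    have c₅ := hs.continuousAt
    obtain ⟨u₁, hu₁⟩ : ∃ u : ℂ → ℂ, ∀ y, r₁ (x - y) = u y := ⟨_, fun _ => rfl⟩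
    obtain ⟨u₂, hu₂⟩ : ∃ u : ℂ → ℂ, ∀ y, r₂ (y - x) = u y := ⟨_, fun _ => rfl⟩
    obtain ⟨u₃, hu₃⟩ : ∃ u : ℂ → ℂ, ∀ y, q (-y) = u y := ⟨_, fun _ => rfl⟩
    unfold K
    simp only [hu₁, hu₂, hu₃] at c₁ c₂ c₃ ⊢
    fun_prop
  have hK0 : K 0 = 0 :=
    tendsto_nhds_unique (hKcont.tendsto.mono_left nhdsWithin_le_nhds)
      (tendsto_const_nhds.congr' (hKzero.mono fun _ h => h.symm))
  simp only [K, sub_zero, neg_zero, hr₁0, hs0, hq0, ht1] at hK0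
  linear_combination (-2) * hK0
end

section
/- Let U ⊆ ℂ be open, connected and symmetric (x ∈ U implies −x ∈ U), let g : ℂ → ℂ be complex-analytic on U, and let a₁ ∈ ℂ. Suppose for all x ∈ U the equation DE-1* holds: g(x)²·g(−x)² − a₁·(g′(x)·g(−x) + g′(−x)·g(x)) + g′(x)·g′(−x) + g″(x)·g(−x) = 0. Then (i) g″(x)·g(−x) = g″(−x)·g(x) for all x ∈ U, and (ii) there exists a constant c ∈ ℂ such that g′(x)·g(−x) + g′(−x)·g(x) = c for all x ∈ U. -/
/-- If `g` is analytic on an open connected symmetric set `U` and satisfies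
DE-1* on `U`, then `g″(x)g(−x) = g″(−x)g(x)` on `U` and
`g′(x)g(−x) + g′(−x)g(x)` is constant on `U`. -/
theorem stmt_5 (U : Set ℂ) (hU : IsOpen U) (hUconn : IsConnected U)
    (hUsymm : ∀ x ∈ U, -x ∈ U)
    (g : ℂ → ℂ) (hg : AnalyticOnNhd ℂ g U) (a₁ : ℂ)
    (hDE : ∀ x ∈ U,
      (g x) ^ 2 * (g (-x)) ^ 2
        - a₁ * (deriv g x * g (-x) + deriv g (-x) * g x)
        + deriv g x * deriv g (-x)
        + deriv (deriv g) x * g (-x) = 0) :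
    (∀ x ∈ U, deriv (deriv g) x * g (-x) = deriv (deriv g) (-x) * g x) ∧
      ∃ c : ℂ, ∀ x ∈ U, deriv g x * g (-x) + deriv g (-x) * g x = c := by
  have symm_second : ∀ x ∈ U, deriv (deriv g) x * g (-x) = deriv (deriv g) (-x) * g x := by
    intro x hx
    have h₁ := hDE x hx
    have h₂ := hDE (-x) (hUsymm x hx)
    rw [neg_neg] at h₂
    linear_combination h₁ - h₂
  have hasDeriv_zero : ∀ x ∈ U,
      HasDerivAt (fun x ↦ deriv g x * g (-x) + deriv g (-x) * g x) 0 x := by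
    intro x hx
    have hx' := hUsymm x hx
    have g_pos := (hg x hx).differentiableAt.hasDerivAt
    have g_neg := (hg (-x) hx').differentiableAt.hasDerivAt.comp x (hasDerivAt_neg x)
    have g'_pos := (hg x hx).deriv.differentiableAt.hasDerivAt
    have g'_neg := (hg (-x) hx').deriv.differentiableAt.hasDerivAt.comp x (hasDerivAt_neg x)
    refine ((g'_pos.mul g_neg).add (g'_neg.mul g_pos)).congr_deriv ?_
    simp only [Function.comp_apply]
    linear_combination symm_second x hx
  exact ⟨symm_second, hU.exists_is_const_of_deriv_eq_zero hUconn.isPreconnected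
    (fun x hx ↦ (hasDeriv_zero x hx).differentiableAt.differentiableWithinAt)
    (fun x hx ↦ (hasDeriv_zero x hx).deriv)⟩
end

section
/- Let U ⊆ ℂ be open, connected and symmetric (x ∈ U implies −x ∈ U), let g : ℂ → ℂ be complex-analytic on U, and let a₁, f₃ ∈ ℂ. Suppose for all x ∈ U both DE-1*: g(x)²·g(−x)² − a₁·(g′(x)·g(−x) + g′(−x)·g(x)) + g′(x)·g′(−x) + g″(x)·g(−x) = 0, and DE-2*: 6f₃·g(x)·g(−x) − 2a₁·(g′(x)·g(−x) + g′(−x)·g(x)) + 2g′(x)·g′(−x) + g″(x)·g(−x) = 0 hold. Define P : U → ℂ by P(x) := −g(x)·g(−x) + 2f₃. Then there exists a constant c ∈ ℂ such that for all x ∈ U: g′(x)·g(−x) + g′(−x)·g(x) = c, 2·g′(x)·g(−x) = c − P′(x), and P″(x) − 6·P(x)² = 2·a₁·c − 24·f₃² (so P satisfies the derivative of a Weierstrass-type equation P′² = 4P³ − g₂P − g₃). -/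
/-- If `g` is analytic on an open connected symmetric set `U` and satisfies
both DE-1* and DE-2* on `U`, then with `P(x) := −g(x)g(−x) + 2f₃` there is a constant `c`
with `g′(x)g(−x) + g′(−x)g(x) = c`, `2g′(x)g(−x) = c − P′(x)`, and
`P″(x) − 6P(x)² = 2a₁c − 24f₃²` on `U`. -/
theorem stmt_6 (U : Set ℂ) (hU : IsOpen U) (hUconn : IsConnected U)
    (hUsymm : ∀ x ∈ U, -x ∈ U)
    (g : ℂ → ℂ) (hg : AnalyticOnNhd ℂ g U) (a₁ f₃ : ℂ)
    (hDE1 : ∀ x ∈ U,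
      (g x) ^ 2 * (g (-x)) ^ 2
        - a₁ * (deriv g x * g (-x) + deriv g (-x) * g x)
        + deriv g x * deriv g (-x)
        + deriv (deriv g) x * g (-x) = 0)
    (hDE2 : ∀ x ∈ U,
      6 * f₃ * (g x * g (-x))
        - 2 * a₁ * (deriv g x * g (-x) + deriv g (-x) * g x)
        + 2 * (deriv g x * deriv g (-x))
        + deriv (deriv g) x * g (-x) = 0) :
    ∃ c : ℂ, ∀ x ∈ U,
      deriv g x * g (-x) + deriv g (-x) * g x = c ∧
      2 * (deriv g x * g (-x)) =
        c - deriv (fun w => -(g w * g (-w)) + 2 * f₃) x ∧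
      deriv (deriv (fun w => -(g w * g (-w)) + 2 * f₃)) x
          - 6 * (-(g x * g (-x)) + 2 * f₃) ^ 2 = 2 * a₁ * c - 24 * f₃ ^ 2 := by
  have hd {x : ℂ} (hx : x ∈ U) : HasDerivAt g (deriv g x) x :=
    (hg x hx).differentiableAt.hasDerivAt
  have hdd {x : ℂ} (hx : x ∈ U) : HasDerivAt (deriv g) (deriv (deriv g) x) x :=
    (hg x hx).deriv.differentiableAt.hasDerivAt
  have hn {f : ℂ → ℂ} {f' x : ℂ} (hf : HasDerivAt f f' (-x)) :
      HasDerivAt (fun w => f (-w)) (-f') x := by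
    exact (hf.comp x (hasDerivAt_neg x)).congr_deriv (by ring)
  have hC (x : ℂ) (hx : x ∈ U) :
      HasDerivAt (fun w => deriv g w * g (-w) + deriv g (-w) * g w) 0 x := by
    have hx' := hUsymm x hx
    refine (((hdd hx).mul (hn (hd hx'))).add ((hn (hdd hx')).mul (hd hx))).congr_deriv ?_
    have h₁ := hDE1 x hx
    have h₂ := hDE1 (-x) hx'
    rw [neg_neg] at h₂
    linear_combination h₁ - h₂
  have hP (x : ℂ) (hx : x ∈ U) :
      HasDerivAt (fun w => -(g w * g (-w)) + 2 * f₃)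
        (g x * deriv g (-x) - deriv g x * g (-x)) x :=
    (((hd hx).mul (hn (hd (hUsymm x hx)))).neg.add_const (2 * f₃)).congr_deriv (by ring)
  have hPP (x : ℂ) (hx : x ∈ U) :
      HasDerivAt (deriv (fun w => -(g w * g (-w)) + 2 * f₃))
        (2 * (deriv g x * deriv g (-x)) - g x * deriv (deriv g) (-x)
          - deriv (deriv g) x * g (-x)) x := by
    have hx' := hUsymm x hx
    have h := ((hd hx).mul (hn (hdd hx'))).sub ((hdd hx).mul (hn (hd hx')))
    refine (h.congr_of_eventuallyEq ?_).congr_deriv (by ring)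
    filter_upwards [hU.mem_nhds hx] with w hw using (hP w hw).deriv
  obtain ⟨c, hc⟩ := hU.exists_is_const_of_deriv_eq_zero hUconn.isPreconnected
    (fun x hx => (hC x hx).differentiableAt.differentiableWithinAt)
    (fun x hx => (hC x hx).deriv)
  refine ⟨c, fun x hx => ⟨hc x hx, ?_, ?_⟩⟩
  · rw [(hP x hx).deriv]
    linear_combination hc x hx
  · rw [(hPP x hx).deriv]
    have h₁ := hDE1 x hx
    have h₂ := hDE2 x hx
    have h₃ := hDE1 (-x) (hUsymm x hx)
    rw [neg_neg] at h₃
    linear_combination (-5) * h₁ - h₃ + 4 * h₂ + 2 * a₁ * hc x hx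
end

section
/- Let f : ℂ → ℂ be entire (differentiable on all of ℂ) and odd (f(−x) = −f(x) for all x), with f′(0) = 1, and suppose f(x+y) = f′(x)·f(y) + f′(y)·f(x) for all x, y ∈ ℂ. Then there exists s ∈ ℂ with s² = f‴(0) such that f(x) = ∑_{n=0}^∞ s^{2n}·x^{2n+1}/(2n+1)! for all x ∈ ℂ; that is, f(x) = sinh(s·x)/s when s ≠ 0, and f(x) = x when f‴(0) = 0. -/
/-- A solution of `f'' = s² f` with `f 0 = 0` and `f' 0 = 1` satisfies `f' + s f = exp (s x)`. -/
theorem deriv_add_mul_eq_exp {f : ℂ → ℂ} {s : ℂ} (hf : Differentiable ℂ f) (hf0 : f 0 = 0)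
    (hf'0 : deriv f 0 = 1) (hode : ∀ x, HasDerivAt (deriv f) (s ^ 2 * f x) x) (x : ℂ) :
    deriv f x + s * f x = Complex.exp (s * x) := by
  have key : ∀ z, HasDerivAt (fun z => (deriv f z + s * f z) * Complex.exp (-(s * z))) 0 z := by
    intro z
    have h1 := (hode z).add ((hf z).hasDerivAt.const_mul s)
    have h2 := (((hasDerivAt_id z).const_mul s).neg).cexp
    refine (h1.mul h2).congr_deriv ?_
    simp only [Pi.add_apply, Pi.neg_apply, id_eq]
    ring
  have hconst := is_const_of_deriv_eq_zero (fun z => (key z).differentiableAt)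
    (fun z => (key z).deriv) x 0
  simp only [hf0, hf'0, mul_zero, add_zero, neg_zero, Complex.exp_zero, mul_one] at hconst
  rw [Complex.exp_neg] at hconst
  field_simp [Complex.exp_ne_zero] at hconst
  exact hconst

/-- A solution of `f'' = s² f` with `f 0 = 0` and `f' 0 = 1` is given by the power series of
`sinh (s x) / s`. -/
theorem hasSum_of_deriv_deriv_eq_sq_mul {f : ℂ → ℂ} {s : ℂ} (hf : Differentiable ℂ f)
    (hf0 : f 0 = 0) (hf'0 : deriv f 0 = 1)
    (hode : ∀ x, HasDerivAt (deriv f) (s ^ 2 * f x) x) (x : ℂ) :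
    HasSum (fun n : ℕ => s ^ (2 * n) * x ^ (2 * n + 1) / (Nat.factorial (2 * n + 1) : ℂ))
      (f x) := by
  have hplus := deriv_add_mul_eq_exp hf hf0 hf'0 hode
  by_cases hs : s = 0
  · subst hs
    have hderiv : ∀ z, deriv f z = 1 := fun z => by simpa using hplus z
    have key : ∀ z, HasDerivAt (fun z => f z - z) 0 z := fun z =>
      ((hf z).hasDerivAt.sub (hasDerivAt_id z)).congr_deriv (by rw [hderiv, sub_self])
    have hconst := is_const_of_deriv_eq_zero (fun z => (key z).differentiableAt)
      (fun z => (key z).deriv) x 0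
    have hfx : f x = x := by
      rw [hf0, sub_zero] at hconst
      exact sub_eq_zero.mp hconst
    rw [hfx]
    convert hasSum_single (f := fun n : ℕ =>
      (0 : ℂ) ^ (2 * n) * x ^ (2 * n + 1) / (Nat.factorial (2 * n + 1) : ℂ)) 0 ?_ using 1
    · simp
    · intro n hn
      simp [hn]
  · have hminus := deriv_add_mul_eq_exp (s := -s) hf hf0 hf'0
      (fun z => by simpa using hode z) x
    have hfx : f x = Complex.sinh (s * x) / s := by
      rw [Complex.sinh, ← neg_mul, ← hplus x, ← hminus]
      field_simp
      ring
    rw [hfx]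
    refine ((Complex.hasSum_sinh (s * x)).div_const s).congr_fun ?_
    intro n
    field_simp
    ring

/-- A differentiable solution of `f (x + y) = f' x * f y + f' y * f x` with `f' 0 = 1`
satisfies `f'' = f''' 0 * f`. -/
theorem hasDerivAt_deriv_of_add {f : ℂ → ℂ} (hf : Differentiable ℂ f)
    (hf'0 : deriv f 0 = 1)
    (hadd : ∀ x y : ℂ, f (x + y) = deriv f x * f y + deriv f y * f x) (x : ℂ) :
    HasDerivAt (deriv f) (deriv (deriv (deriv f)) 0 * f x) x := by
  have hf' : Differentiable ℂ (deriv f) := hf.deriv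
  have hf'' : Differentiable ℂ (deriv (deriv f)) := hf'.deriv
  have h1 : ∀ x y, deriv f (x + y) = deriv f x * deriv f y + deriv (deriv f) y * f x := by
    intro x y
    have hl := (hf (x + y)).hasDerivAt.comp_const_add x y
    have hr := ((hf y).hasDerivAt.const_mul (deriv f x)).add ((hf' y).hasDerivAt.mul_const (f x))
    exact hl.unique (hr.congr_of_eventuallyEq (.of_forall fun z => hadd x z))
  have h2 : ∀ x, deriv (deriv f) x =
      deriv f x * deriv (deriv f) 0 + deriv (deriv (deriv f)) 0 * f x := by
    intro x
    have hl := (hf' (x + 0)).hasDerivAt.comp_const_add x 0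
    have hr := ((hf' 0).hasDerivAt.const_mul (deriv f x)).add
      ((hf'' 0).hasDerivAt.mul_const (f x))
    simpa using hl.unique (hr.congr_of_eventuallyEq (.of_forall fun z => h1 x z))
  have h3 : deriv (deriv f) 0 = 0 := by
    have hz : ∀ z, deriv (deriv f) 0 * f z = 0 := fun z => by
      simpa [hf'0] using h1 z 0
    have hd := (hf 0).hasDerivAt.const_mul (deriv (deriv f) 0)
    rw [hf'0, mul_one] at hd
    exact hd.unique ((hasDerivAt_const (0 : ℂ) (0 : ℂ)).congr_of_eventuallyEq
      (.of_forall hz))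
  have hx := (hf' x).hasDerivAt
  rwa [h2 x, h3, mul_zero, zero_add] at hx

/-- An entire odd function `f` with `f′(0) = 1` satisfying the addition law
`f(x+y) = f′(x)f(y) + f′(y)f(x)` is `sinh(sx)/s` for some `s` with `s² = f‴(0)`
(interpreted as `x` when `s = 0`), i.e. `f(x) = ∑ s^{2n} x^{2n+1}/(2n+1)!`. -/
theorem stmt_7 (f : ℂ → ℂ) (hf : Differentiable ℂ f)
    (hodd : ∀ x : ℂ, f (-x) = -f x) (hf'0 : deriv f 0 = 1)
    (hadd : ∀ x y : ℂ, f (x + y) = deriv f x * f y + deriv f y * f x) :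
    ∃ s : ℂ, s ^ 2 = deriv (deriv (deriv f)) 0 ∧
      ∀ x : ℂ, f x = ∑' n : ℕ,
        s ^ (2 * n) * x ^ (2 * n + 1) / (Nat.factorial (2 * n + 1) : ℂ) := by
  have hf0 : f 0 = 0 := by
    have h := hodd 0
    rw [neg_zero] at h
    exact self_eq_neg.mp h
  obtain ⟨s, hs⟩ := IsAlgClosed.exists_pow_nat_eq (deriv (deriv (deriv f)) 0) two_pos
  refine ⟨s, hs, fun x => ?_⟩
  refine (hasSum_of_deriv_deriv_eq_sq_mul hf hf0 hf'0 (fun z => ?_) x).tsum_eq.symm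
  rw [hs]
  exact hasDerivAt_deriv_of_add hf hf'0 hadd z
end

section
/- For all k, s, a₁ ∈ ℂ, the functions f(x) := exp(k·x)·∑_{n=0}^∞ s^{2n}·x^{2n+1}/(2n+1)! and A(x) := exp(−k·x)·(a₁·∑_{n=0}^∞ s^{2n}·x^{2n+1}/(2n+1)! + ∑_{n=0}^∞ s^{2n}·x^{2n}/(2n)!) satisfy f(x−y)·f(y−x) = A(x)·f(y)·f(x−y) + A(y)·f(x)·f(y−x) for all x, y ∈ ℂ. (For s ≠ 0 this says the pair f(x) = e^{kx}·sinh(sx)/s, A(x) = e^{−kx}·(a₁·sinh(sx)/s + cosh(sx)) solves the functional equation.) -/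
/-- The entire function `w ↦ sinh (s * w) / s`, extended by `w ↦ w` at `s = 0`. -/
noncomputable def sinhDiv (s w : ℂ) : ℂ :=
  if s = 0 then w else Complex.sinh (s * w) / s

theorem tsum_sinhDiv (s w : ℂ) :
    ∑' n : ℕ, s ^ (2 * n) * w ^ (2 * n + 1) / (Nat.factorial (2 * n + 1) : ℂ) =
      sinhDiv s w := by
  by_cases hs : s = 0
  · rw [tsum_eq_single 0 fun n hn => by simp [hs, hn]]
    simp [sinhDiv, hs]
  · rw [sinhDiv, if_neg hs, ← ((Complex.hasSum_sinh (s * w)).div_const s).tsum_eq]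
    refine tsum_congr fun n => ?_
    rw [mul_pow, pow_succ s]
    field_simp

theorem tsum_cosh_mul (s w : ℂ) :
    ∑' n : ℕ, s ^ (2 * n) * w ^ (2 * n) / (Nat.factorial (2 * n) : ℂ) =
      Complex.cosh (s * w) := by
  simp only [Complex.cosh_eq_tsum, mul_pow]

theorem sinhDiv_sub (s x y : ℂ) :
    sinhDiv s (x - y) =
      sinhDiv s x * Complex.cosh (s * y) - Complex.cosh (s * x) * sinhDiv s y := by
  by_cases hs : s = 0
  · simp [sinhDiv, hs]
  · simp only [sinhDiv, if_neg hs, mul_sub, Complex.sinh_sub]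
    ring

/-- For all `k, s, a₁ ∈ ℂ`, the pair
`f(x) = e^{kx}·sinh(sx)/s` and `A(x) = e^{−kx}·(a₁·sinh(sx)/s + cosh(sx))`
(written via everywhere-converging power series so that `s = 0` is allowed)
solves the functional equation `f(x−y)f(y−x) = A(x)f(y)f(x−y) + A(y)f(x)f(y−x)`. -/
theorem stmt_8 (k s a₁ : ℂ) :
    ∀ x y : ℂ,
      (fun w : ℂ => Complex.exp (k * w) *
          ∑' n : ℕ, s ^ (2 * n) * w ^ (2 * n + 1) / (Nat.factorial (2 * n + 1) : ℂ)) (x - y) *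
        (fun w : ℂ => Complex.exp (k * w) *
          ∑' n : ℕ, s ^ (2 * n) * w ^ (2 * n + 1) / (Nat.factorial (2 * n + 1) : ℂ)) (y - x) =
      (fun w : ℂ => Complex.exp (-(k * w)) *
          (a₁ * ∑' n : ℕ, s ^ (2 * n) * w ^ (2 * n + 1) / (Nat.factorial (2 * n + 1) : ℂ)
            + ∑' n : ℕ, s ^ (2 * n) * w ^ (2 * n) / (Nat.factorial (2 * n) : ℂ))) x *
        (fun w : ℂ => Complex.exp (k * w) *
          ∑' n : ℕ, s ^ (2 * n) * w ^ (2 * n + 1) / (Nat.factorial (2 * n + 1) : ℂ)) y *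
        (fun w : ℂ => Complex.exp (k * w) *
          ∑' n : ℕ, s ^ (2 * n) * w ^ (2 * n + 1) / (Nat.factorial (2 * n + 1) : ℂ)) (x - y) +
      (fun w : ℂ => Complex.exp (-(k * w)) *
          (a₁ * ∑' n : ℕ, s ^ (2 * n) * w ^ (2 * n + 1) / (Nat.factorial (2 * n + 1) : ℂ)
            + ∑' n : ℕ, s ^ (2 * n) * w ^ (2 * n) / (Nat.factorial (2 * n) : ℂ))) y *
        (fun w : ℂ => Complex.exp (k * w) *
          ∑' n : ℕ, s ^ (2 * n) * w ^ (2 * n + 1) / (Nat.factorial (2 * n + 1) : ℂ)) x *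
        (fun w : ℂ => Complex.exp (k * w) *
          ∑' n : ℕ, s ^ (2 * n) * w ^ (2 * n + 1) / (Nat.factorial (2 * n + 1) : ℂ)) (y - x) := by
  intro x y
  simp only [tsum_sinhDiv, tsum_cosh_mul, sinhDiv_sub, mul_sub, Complex.exp_sub, Complex.exp_neg]
  have hx := Complex.exp_ne_zero (k * x)
  have hy := Complex.exp_ne_zero (k * y)
  field_simp
  ring
end

section
/- Let r ≥ 2 be a natural number, k ∈ ℂ, and z ∈ ℂ with sin z ≠ 0 and sin(r·z) ≠ 0. Define f(w) := exp(k·w)·sin(w)·sin(z)/sin(w+z) and A(t) := exp(−(r−1)·k·t)·sin(t+r·z)·sin(z)/(sin(t+z)·sin(r·z)). Let x : Fin r → ℂ be such that for every i: sin(xᵢ) ≠ 0 and sin(xᵢ+z) ≠ 0, and for every pair i ≠ j: sin(xᵢ−xⱼ) ≠ 0 and sin(xᵢ−xⱼ+z) ≠ 0. Then 1/∏_{i} f(xᵢ) = ∑_{j} A(xⱼ)/(f(xⱼ)·∏_{i≠j} f(xᵢ−xⱼ)). -/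
open Complex Finset

/-- Partial fraction expansion of `∏ᵢ (t - q uᵢ) / (t - uᵢ)` in the variable `t`. -/
theorem prod_sub_mul_div_prod_sub_eq {ι F : Type*} [Fintype ι] [DecidableEq ι] [Field F]
    (u : ι → F) (hu : Function.Injective u) (q t : F) (ht : ∀ i, t ≠ u i) :
    ∏ i, (t - q * u i) / (t - u i) =
      1 + (q - 1) * ∑ j, u j / (u j - t) *
        ∏ i ∈ univ.erase j, (q * u i - u j) / (u i - u j) := by
  open Polynomial in
  set N : F[X] := Lagrange.nodal univ (fun i => q * u i) with hN
  set D : F[X] := Lagrange.nodal univ u with hD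
  have hdeg : (N - D).degree < (univ : Finset ι).card := by
    have h := Polynomial.degree_sub_lt_left (p := N) (q := D)
      (by rw [hN, hD, Lagrange.degree_nodal, Lagrange.degree_nodal])
      (Lagrange.nodal_ne_zero)
      (by rw [hN, hD, Lagrange.nodal_monic.leadingCoeff, Lagrange.nodal_monic.leadingCoeff])
    rwa [hN, Lagrange.degree_nodal] at h
  have hint := Lagrange.eq_interpolate (s := univ) (v := u) hu.injOn hdeg
  have hev := congrArg (Polynomial.eval t) hint
  rw [Lagrange.eval_interpolate_not_at_node _ (fun i _ => ht i), Polynomial.eval_sub] at hev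
  have hD0 : Polynomial.eval t D ≠ 0 := by
    rw [hD, Lagrange.eval_nodal]
    exact prod_ne_zero_iff.2 fun i _ => sub_ne_zero.2 (ht i)
  have hterm : ∀ j, Lagrange.nodalWeight univ u j * (t - u j)⁻¹ * Polynomial.eval (u j) (N - D) =
      (q - 1) * (u j / (u j - t) * ∏ i ∈ univ.erase j, (q * u i - u j) / (u i - u j)) := by
    intro j
    have h1 : Polynomial.eval (u j) D = 0 := Lagrange.eval_nodal_at_node (mem_univ j)
    have h2 : ∏ i ∈ univ.erase j, (q * u i - u j) / (u i - u j) =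
        ∏ i ∈ univ.erase j, ((u j - u i)⁻¹ * (u j - q * u i)) :=
      prod_congr rfl fun i _ => by
        rw [← neg_sub (u j) (u i), ← neg_sub (u j) (q * u i), neg_div_neg_eq, div_eq_inv_mul]
    rw [Polynomial.eval_sub, h1, sub_zero, hN, Lagrange.eval_nodal,
      ← mul_prod_erase univ _ (mem_univ j), h2, prod_mul_distrib, Lagrange.nodalWeight,
      ← neg_sub t (u j), div_neg, div_eq_mul_inv]
    ring
  rw [sum_congr rfl fun j _ => hterm j, ← mul_sum] at hev
  rw [prod_div_distrib, ← Lagrange.eval_nodal, ← Lagrange.eval_nodal, ← hN, ← hD,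
    div_eq_iff hD0]
  linear_combination hev

/-- The functional equation in multiplicative variables. -/
theorem prod_mul_sub_one_div_eq_sum {ι F : Type*} [Fintype ι] [DecidableEq ι] [Field F]
    (u : ι → F) (hu : Function.Injective u) (hu0 : ∀ i, u i ≠ 0) (hu1 : ∀ i, u i ≠ 1)
    (q : F) (hq : q ^ Fintype.card ι ≠ 1) :
    ∏ i, (q * u i - 1) / (u i - 1) =
      (q - 1) / (q ^ Fintype.card ι - 1) *
        ∑ j, (q ^ Fintype.card ι * u j - 1) / (u j - 1) *
          ∏ i ∈ univ.erase j, (q * u i - u j) / (u i - u j) := by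
  have h1 := prod_sub_mul_div_prod_sub_eq u hu q 1 fun i => (hu1 i).symm
  have h0 := prod_sub_mul_div_prod_sub_eq u hu q 0 fun i => (hu0 i).symm
  have hl : ∏ i, (q * u i - 1) / (u i - 1) = ∏ i, (1 - q * u i) / (1 - u i) :=
    prod_congr rfl fun i _ => by
      rw [← neg_sub 1 (u i), ← neg_sub 1 (q * u i), neg_div_neg_eq]
  have hc : ∏ i, (0 - q * u i) / (0 - u i) = q ^ Fintype.card ι := by
    rw [prod_congr rfl (g := fun _ => q) fun i _ => by
      rw [zero_sub, zero_sub, neg_div_neg_eq, mul_div_cancel_right₀ _ (hu0 i)]]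
    simp
  simp only [sub_zero, div_self (hu0 _), one_mul] at h0
  rw [hc] at h0
  have hs : ∑ j, (q ^ Fintype.card ι * u j - 1) / (u j - 1) *
        ∏ i ∈ univ.erase j, (q * u i - u j) / (u i - u j) =
      ∑ j, ∏ i ∈ univ.erase j, (q * u i - u j) / (u i - u j) +
        (q ^ Fintype.card ι - 1) * ∑ j, u j / (u j - 1) *
          ∏ i ∈ univ.erase j, (q * u i - u j) / (u i - u j) := by
    rw [mul_sum, ← sum_add_distrib]
    refine sum_congr rfl fun j _ => ?_
    have := sub_ne_zero.2 (hu1 j)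
    field_simp
    ring
  have hq' := sub_ne_zero.2 hq
  rw [hl, h1, hs, div_mul_eq_mul_div, eq_div_iff hq']
  linear_combination h0

theorem Complex.sin_eq_exp_two_mul_sub_one (w : ℂ) :
    sin w = (exp (2 * w * I) - 1) * (exp (-w * I) / (2 * I)) := by
  have h : exp (2 * w * I) * exp (-w * I) = exp (w * I) := by
    rw [← exp_add]; congr 1; ring
  rw [sin, ← h]
  field_simp
  rw [I_sq]
  ring

theorem Complex.sin_add_div_sin (w z : ℂ) :
    sin (w + z) / sin w =
      (exp (2 * z * I) * exp (2 * w * I) - 1) / (exp (2 * w * I) - 1) * exp (-z * I) := by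
  have h1 : exp (2 * (w + z) * I) = exp (2 * z * I) * exp (2 * w * I) := by
    rw [← exp_add]; congr 1; ring
  have h2 : exp (-(w + z) * I) = exp (-z * I) * exp (-w * I) := by
    rw [← exp_add]; congr 1; ring
  rw [sin_eq_exp_two_mul_sub_one w, sin_eq_exp_two_mul_sub_one (w + z), h1, h2,
    mul_div_mul_comm]
  congr 1
  have := exp_ne_zero (-w * I)
  field_simp

theorem Complex.exp_two_mul_eq_one_iff (w : ℂ) : exp (2 * w * I) = 1 ↔ sin w = 0 := by
  rw [sin_eq_exp_two_mul_sub_one]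
  simp [exp_ne_zero, sub_eq_zero]

/-- The functional equation with all exponential factors `exp (k * _)` removed. -/
theorem Complex.prod_sin_add_div_sin_eq_sum (r : ℕ) (hr : r ≠ 0) (z : ℂ)
    (hrz : sin ((r : ℂ) * z) ≠ 0) (x : Fin r → ℂ) (hx : ∀ i, sin (x i) ≠ 0)
    (hxx : ∀ i j, i ≠ j → sin (x i - x j) ≠ 0) :
    ∏ i, sin (x i + z) / sin (x i) =
      sin z / sin (r * z) * ∑ j, sin (x j + r * z) / sin (x j) *
        ∏ i ∈ univ.erase j, sin (x i - x j + z) / sin (x i - x j) := by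
  set u : Fin r → ℂ := fun i => exp (2 * x i * I) with hu
  set q := exp (2 * z * I) with hq
  set s := exp (-z * I) with hs
  have hs0 : s ≠ 0 := exp_ne_zero _
  have hqr : exp (2 * (r * z) * I) = q ^ r := by
    rw [hq, ← exp_nat_mul]; congr 1; ring
  have hsr : exp (-(r * z) * I) = s ^ r := by
    rw [hs, ← exp_nat_mul]; congr 1; ring
  have hu0 : ∀ i, u i ≠ 0 := fun i => exp_ne_zero _
  have hdiv : ∀ i j, exp (2 * (x i - x j) * I) = u i / u j := fun i j => by
    rw [hu, ← exp_sub]; congr 1; ring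
  have hinj : Function.Injective u := fun i j h => by
    by_contra hij
    exact hxx i j hij ((exp_two_mul_eq_one_iff _).1 (by rw [hdiv, h, div_self (hu0 j)]))
  have key := prod_mul_sub_one_div_eq_sum u hinj hu0
    (fun i h => hx i ((exp_two_mul_eq_one_iff _).1 h)) q
    (by rw [Fintype.card_fin, ← hqr]; exact fun h => hrz ((exp_two_mul_eq_one_iff _).1 h))
  rw [Fintype.card_fin] at key
  have hpair : ∀ i j, sin (x i - x j + z) / sin (x i - x j) =
      (q * u i - u j) / (u i - u j) * s := fun i j => by
    have := hu0 j
    rw [sin_add_div_sin, hdiv, ← hq, ← hs, ← mul_div_mul_right _ (u i / u j - 1) this]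
    congr 2 <;> field_simp
  have hz : sin z / sin (r * z) = (q - 1) / (q ^ r - 1) * (s / s ^ r) := by
    rw [sin_eq_exp_two_mul_sub_one z, sin_eq_exp_two_mul_sub_one (r * z), hqr, hsr, ← hq, ← hs,
      mul_div_mul_comm]
    congr 1
    have := pow_ne_zero r hs0
    field_simp
  have hterm : ∀ j, sin (x j + r * z) / sin (x j) *
        ∏ i ∈ univ.erase j, sin (x i - x j + z) / sin (x i - x j) =
      s ^ r * s ^ (r - 1) * ((q ^ r * u j - 1) / (u j - 1) *
        ∏ i ∈ univ.erase j, (q * u i - u j) / (u i - u j)) := fun j => by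
    rw [sin_add_div_sin, hqr, hsr, prod_congr rfl fun i _ => hpair i j, prod_mul_distrib,
      prod_const, card_erase_of_mem (mem_univ j), card_univ, Fintype.card_fin]
    ring
  rw [prod_congr rfl fun i _ => sin_add_div_sin (x i) z, prod_mul_distrib, prod_const,
    card_univ, Fintype.card_fin, ← hs, key, hz, sum_congr rfl fun j _ => hterm j, ← mul_sum]
  obtain ⟨n, rfl⟩ := Nat.exists_eq_succ_of_ne_zero hr
  rw [Nat.succ_sub_one, pow_succ s]
  field_simp

/-- The `r`-variable functional equation
`1/∏ᵢ f(xᵢ) = ∑ⱼ A(xⱼ)/(f(xⱼ)·∏_{i≠j} f(xᵢ−xⱼ))` holds for the trigonometric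
degeneration of the complex elliptic genus, `f(w) = e^{kw} sin w sin z / sin(w+z)`
with Jacobian factor `A(t) = e^{−(r−1)kt} sin(t+rz) sin z / (sin(t+z) sin(rz))`,
provided `z` is not an "`r`-torsion point" (`sin z ≠ 0`, `sin(rz) ≠ 0`) and the
arguments avoid the zeros and poles. -/
theorem stmt_9 (r : ℕ) (hr : 2 ≤ r) (k z : ℂ)
    (hz : Complex.sin z ≠ 0) (hrz : Complex.sin ((r : ℂ) * z) ≠ 0)
    (x : Fin r → ℂ)
    (hx : ∀ i, Complex.sin (x i) ≠ 0 ∧ Complex.sin (x i + z) ≠ 0)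
    (hxx : ∀ i j, i ≠ j →
      Complex.sin (x i - x j) ≠ 0 ∧ Complex.sin (x i - x j + z) ≠ 0) :
    1 / ∏ i, (Complex.exp (k * x i) * Complex.sin (x i) * Complex.sin z /
        Complex.sin (x i + z)) =
      ∑ j, (Complex.exp (-(((r : ℂ) - 1) * k * x j)) * Complex.sin (x j + (r : ℂ) * z) *
            Complex.sin z / (Complex.sin (x j + z) * Complex.sin ((r : ℂ) * z))) /
        ((Complex.exp (k * x j) * Complex.sin (x j) * Complex.sin z /
            Complex.sin (x j + z)) *
          ∏ i ∈ Finset.univ.erase j,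
            (Complex.exp (k * (x i - x j)) * Complex.sin (x i - x j) * Complex.sin z /
              Complex.sin (x i - x j + z))) := by
  have hinv : ∀ w, (exp (k * w) * sin w * sin z / sin (w + z))⁻¹ =
      exp (-(k * w)) * (sin z)⁻¹ * (sin (w + z) / sin w) := fun w => by
    rw [exp_neg, inv_div, div_eq_mul_inv, div_eq_mul_inv, mul_inv, mul_inv]
    ring
  have hr' : (((r - 1 : ℕ) : ℂ)) = r - 1 := by
    rw [Nat.cast_sub (by omega), Nat.cast_one]
  have hterm : ∀ j, (exp (-(((r : ℂ) - 1) * k * x j)) * sin (x j + (r : ℂ) * z) *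
            sin z / (sin (x j + z) * sin ((r : ℂ) * z))) /
        ((exp (k * x j) * sin (x j) * sin z / sin (x j + z)) *
          ∏ i ∈ univ.erase j,
            (exp (k * (x i - x j)) * sin (x i - x j) * sin z / sin (x i - x j + z))) =
      exp (-(k * ∑ i, x i)) * (sin z)⁻¹ ^ r * (sin z / sin (r * z) *
        (sin (x j + r * z) / sin (x j) *
          ∏ i ∈ univ.erase j, sin (x i - x j + z) / sin (x i - x j))) := fun j => by
    have hexp : exp (-(((r : ℂ) - 1) * k * x j)) * exp (-(k * x j)) *
        exp (∑ i ∈ univ.erase j, -(k * (x i - x j))) = exp (-(k * ∑ i, x i)) := by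
      rw [← exp_add, ← exp_add, sum_neg_distrib, ← mul_sum, sum_sub_distrib, sum_const,
        card_erase_of_mem (mem_univ j), card_univ, Fintype.card_fin, nsmul_eq_mul, hr',
        ← add_sum_erase univ x (mem_univ j)]
      congr 1
      ring
    have hpow : (sin z)⁻¹ ^ r = (sin z)⁻¹ * (sin z)⁻¹ ^ (r - 1) := by
      rw [← pow_succ', Nat.sub_add_cancel (by omega)]
    rw [div_eq_mul_inv _ (_ * _), mul_inv, ← prod_inv_distrib, hinv,
      prod_congr rfl fun i _ => hinv (x i - x j), prod_mul_distrib, prod_mul_distrib,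
      prod_const, card_erase_of_mem (mem_univ j), card_univ, Fintype.card_fin, ← exp_sum,
      ← hexp, hpow]
    have h1 := (hx j).1
    have h2 := (hx j).2
    field_simp
  rw [sum_congr rfl fun j _ => hterm j, ← mul_sum, ← mul_sum,
    ← prod_sin_add_div_sin_eq_sum r (by omega) z hrz x (fun i => (hx i).1)
      (fun i j hij => (hxx i j hij).1),
    one_div, ← prod_inv_distrib, prod_congr rfl fun i _ => hinv (x i), prod_mul_distrib,
    prod_mul_distrib, prod_const, card_univ, Fintype.card_fin, ← exp_sum, sum_neg_distrib,
    ← mul_sum]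
end

section
/- Let k ∈ ℂ and z ∈ ℂ with sin z ≠ 0 and sin(2z) ≠ 0. Define f(w) := exp(k·w)·sin(w)·sin(z)/sin(w+z) and A(t) := exp(−k·t)·sin(t+2z)·sin(z)/(sin(t+z)·sin(2z)). Then for all x, y ∈ ℂ with sin(x+z) ≠ 0, sin(y+z) ≠ 0, sin(x−y+z) ≠ 0 and sin(y−x+z) ≠ 0: f(x−y)·f(y−x) = A(x)·f(y)·f(x−y) + A(y)·f(x)·f(y−x). -/
open Complex

/-- A three-variable trigonometric addition identity. -/
lemma sin_sub_mul_sin_add_mul_sin_add_mul_sin_two_mul (x y z : ℂ) :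
    Complex.sin (x - y) * Complex.sin (y - x) * Complex.sin (x + z) * Complex.sin (y + z) *
        Complex.sin (2 * z) =
      Complex.sin z * (Complex.sin (x + 2 * z) * Complex.sin y * Complex.sin (x - y) *
          Complex.sin (y - x + z) +
        Complex.sin (y + 2 * z) * Complex.sin x * Complex.sin (y - x) *
          Complex.sin (x - y + z)) := by
  have hx := Complex.exp_ne_zero (x * I)
  have hy := Complex.exp_ne_zero (y * I)
  have hz := Complex.exp_ne_zero (z * I)
  simp only [Complex.sin, two_mul, neg_mul, add_mul, sub_mul, Complex.exp_neg, Complex.exp_add,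
    Complex.exp_sub]
  field_simp
  ring

/-- The trigonometric (degenerate lattice) members of the complex elliptic
genera, `f(w) = e^{kw} sin w sin z / sin(w+z)` with Jacobian factor
`A(t) = e^{−kt} sin(t+2z) sin z / (sin(t+z) sin 2z)`, solve the functional equation
`f(x−y)f(y−x) = A(x)f(y)f(x−y) + A(y)f(x)f(y−x)` wherever defined. -/
theorem stmt_10 (k z : ℂ) (hz : Complex.sin z ≠ 0) (h2z : Complex.sin (2 * z) ≠ 0) :
    ∀ x y : ℂ, Complex.sin (x + z) ≠ 0 → Complex.sin (y + z) ≠ 0 →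
      Complex.sin (x - y + z) ≠ 0 → Complex.sin (y - x + z) ≠ 0 →
      (Complex.exp (k * (x - y)) * Complex.sin (x - y) * Complex.sin z /
          Complex.sin (x - y + z)) *
        (Complex.exp (k * (y - x)) * Complex.sin (y - x) * Complex.sin z /
          Complex.sin (y - x + z)) =
      (Complex.exp (-(k * x)) * Complex.sin (x + 2 * z) * Complex.sin z /
          (Complex.sin (x + z) * Complex.sin (2 * z))) *
        (Complex.exp (k * y) * Complex.sin y * Complex.sin z / Complex.sin (y + z)) *
        (Complex.exp (k * (x - y)) * Complex.sin (x - y) * Complex.sin z /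
          Complex.sin (x - y + z)) +
      (Complex.exp (-(k * y)) * Complex.sin (y + 2 * z) * Complex.sin z /
          (Complex.sin (y + z) * Complex.sin (2 * z))) *
        (Complex.exp (k * x) * Complex.sin x * Complex.sin z / Complex.sin (x + z)) *
        (Complex.exp (k * (y - x)) * Complex.sin (y - x) * Complex.sin z /
          Complex.sin (y - x + z)) := by
  intro x y hx hy hxy hyx
  have h₀ : exp (k * (x - y)) * exp (k * (y - x)) = 1 := by
    rw [← Complex.exp_add, ← Complex.exp_zero]; ring_nf
  have h₁ : exp (-(k * x)) * exp (k * y) * exp (k * (x - y)) = 1 := by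
    rw [← Complex.exp_add, ← Complex.exp_add, ← Complex.exp_zero]; ring_nf
  have h₂ : exp (-(k * y)) * exp (k * x) * exp (k * (y - x)) = 1 := by
    rw [← Complex.exp_add, ← Complex.exp_add, ← Complex.exp_zero]; ring_nf
  have key := sin_sub_mul_sin_add_mul_sin_add_mul_sin_two_mul x y z
  generalize Complex.sin (x + 2 * z) = u, Complex.sin (y + 2 * z) = v, Complex.sin (2 * z) = w,
    Complex.sin (x + z) = a, Complex.sin (y + z) = b, Complex.sin (x - y + z) = c,
    Complex.sin (y - x + z) = d, Complex.sin (x - y) = s, Complex.sin (y - x) = t,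
    Complex.sin z = r, Complex.sin x = m, Complex.sin y = n at *
  have hmain : s * t * r ^ 2 / (c * d) =
      u * r ^ 3 * n * s / (a * w * b * c) + v * r ^ 3 * m * t / (b * w * a * d) := by
    field_simp
    linear_combination key
  linear_combination hmain + s * t * r ^ 2 / (c * d) * h₀ -
    u * r ^ 3 * n * s / (a * w * b * c) * h₁ - v * r ^ 3 * m * t / (b * w * a * d) * h₂
end

section
/- Let σ : ℂ → ℂ and ω, η ∈ ℂ satisfy the quasi-periodicity law σ(u+ω) = −exp(η·(u+ω/2))·σ(u) for all u ∈ ℂ. Let r be a natural number, λ, μ : Fin r → ℤ and a, b : Fin r → ℂ, and assume ∑ⱼ λⱼ² = ∑ⱼ μⱼ², ∑ⱼ λⱼ·aⱼ = ∑ⱼ μⱼ·bⱼ, and ∑ⱼ λⱼ ≡ ∑ⱼ μⱼ (mod 2). Then for all z ∈ ℂ: ∏ⱼ σ(λⱼ·(z+ω) − aⱼ) · ∏ⱼ σ(μⱼ·z − bⱼ) = ∏ⱼ σ(λⱼ·z − aⱼ) · ∏ⱼ σ(μⱼ·(z+ω) − bⱼ). (Equivalently, the meromorphic function ∏ⱼ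 σ(λⱼz−aⱼ)/∏ⱼ σ(μⱼz−bⱼ) is periodic with period ω wherever it is defined.) -/
open Finset

/-- The sigma transformation law iterated along an integer multiple of the period; the sign
`(-1) ^ n` is written as `exp (n * π * I)`. -/
theorem sigma_add_int_mul_period {σ : ℂ → ℂ} {ω η : ℂ}
    (hσ : ∀ u : ℂ, σ (u + ω) = -Complex.exp (η * (u + ω / 2)) * σ u) (n : ℤ) (u : ℂ) :
    σ (u + n * ω) =
      Complex.exp (n * (Real.pi * Complex.I) + η * (n * u + n ^ 2 * (ω / 2))) * σ u := by
  have hstep (v : ℂ) :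
      σ (v + ω) = Complex.exp (Real.pi * Complex.I + η * (v + ω / 2)) * σ v := by
    rw [hσ, Complex.exp_add, Complex.exp_pi_mul_I, neg_one_mul]
  induction n using Int.induction_on with
  | zero => simp
  | succ k ih =>
    rw [show u + ((k + 1 : ℤ) : ℂ) * ω = u + (k : ℤ) * ω + ω by push_cast; ring, hstep, ih,
      ← mul_assoc, ← Complex.exp_add]
    congr 2
    push_cast
    ring
  | pred k ih =>
    have h := hstep (u + ((-k - 1 : ℤ) : ℂ) * ω)
    rw [show u + ((-k - 1 : ℤ) : ℂ) * ω + ω = u + (-k : ℤ) * ω by push_cast; ring, ih] at h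
    refine mul_left_cancel₀ (Complex.exp_ne_zero _) (h.symm.trans ?_)
    rw [← mul_assoc (Complex.exp _), ← Complex.exp_add]
    congr 2
    push_cast
    ring

/-- The multiplier acquired by a product of sigma factors under translation by the period. -/
theorem prod_sigma_add_period {σ : ℂ → ℂ} {ω η : ℂ}
    (hσ : ∀ u : ℂ, σ (u + ω) = -Complex.exp (η * (u + ω / 2)) * σ u)
    {ι : Type*} (s : Finset ι) (l : ι → ℤ) (a : ι → ℂ) (z : ℂ) :
    ∏ j ∈ s, σ (l j * (z + ω) - a j) =
      Complex.exp (((∑ j ∈ s, l j : ℤ) : ℂ) * (Real.pi * Complex.I) +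
        η * (((∑ j ∈ s, l j ^ 2 : ℤ) : ℂ) * (z + ω / 2) - ∑ j ∈ s, l j * a j)) *
      ∏ j ∈ s, σ (l j * z - a j) := by
  have hfactor (j : ι) : σ (l j * (z + ω) - a j) =
      Complex.exp (l j * (Real.pi * Complex.I) + η * (l j ^ 2 * (z + ω / 2) - l j * a j)) *
        σ (l j * z - a j) := by
    rw [show (l j : ℂ) * (z + ω) - a j = l j * z - a j + l j * ω by ring,
      sigma_add_int_mul_period hσ]
    congr 2
    ring
  simp_rw [hfactor]
  rw [prod_mul_distrib, ← Complex.exp_sum]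
  congr 2
  push_cast
  rw [sum_add_distrib, ← sum_mul, ← mul_sum, sum_sub_distrib, ← sum_mul]

/-- ellipticity criterion, Lemma 4.1, in cross-multiplied form: for any
function `σ` satisfying the sigma transformation law `σ(u+ω) = −e^{η(u+ω/2)}σ(u)`,
if `∑λⱼ² = ∑μⱼ²`, `∑λⱼaⱼ = ∑μⱼbⱼ` and `∑λⱼ ≡ ∑μⱼ (mod 2)`, then
`∏ σ(λⱼz−aⱼ)/∏ σ(μⱼz−bⱼ)` is `ω`-periodic. -/
theorem stmt_16 (σ : ℂ → ℂ) (ω η : ℂ)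
    (hσ : ∀ u : ℂ, σ (u + ω) = -Complex.exp (η * (u + ω / 2)) * σ u)
    (r : ℕ) (l m : Fin r → ℤ) (a b : Fin r → ℂ)
    (hsq : ∑ j, (l j) ^ 2 = ∑ j, (m j) ^ 2)
    (hlin : ∑ j, (l j : ℂ) * a j = ∑ j, (m j : ℂ) * b j)
    (hmod : (∑ j, l j) % 2 = (∑ j, m j) % 2) :
    ∀ z : ℂ,
      (∏ j, σ ((l j : ℂ) * (z + ω) - a j)) * (∏ j, σ ((m j : ℂ) * z - b j)) =
        (∏ j, σ ((l j : ℂ) * z - a j)) * (∏ j, σ ((m j : ℂ) * (z + ω) - b j)) := by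
  intro z
  have hsign : Complex.exp (((∑ j, l j : ℤ) : ℂ) * (Real.pi * Complex.I)) =
      Complex.exp (((∑ j, m j : ℤ) : ℂ) * (Real.pi * Complex.I)) := by
    obtain ⟨k, hk⟩ := Int.ModEq.dvd (show ∑ j, m j ≡ ∑ j, l j [ZMOD 2] from hmod.symm)
    refine Complex.exp_eq_exp_iff_exists_int.mpr ⟨k, ?_⟩
    rw [eq_add_of_sub_eq hk]
    push_cast
    ring
  rw [prod_sigma_add_period hσ, prod_sigma_add_period hσ, Complex.exp_add, Complex.exp_add,
    hsign, hsq, hlin]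
  ring
end

section
/- Let R > 0 and let f : ℂ → ℂ be complex-analytic on the open ball B(0,R), with f(0) = 0, f′(0) = 1, f″(0) = 0, and f(x) ≠ 0 for all x ∈ B(0,R) \ {0}. Define g(x) := 1/f(x) on B(0,R) \ {0}, and suppose there is a constant c ∈ ℂ with g′(x)·g(−x) + g′(−x)·g(x) = c for all x ∈ B(0,R) \ {0}. Then c = f⁗(0)/4, i.e. c = 6·f₄ where f₄ is the fourth Taylor coefficient of f at 0. -/
open Metric

/-- for `f` analytic on `B(0,R)` with `f(0)=0`, `f′(0)=1`, `f″(0)=0` and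
`f ≠ 0` away from `0`, if `g = 1/f` satisfies `g′(x)g(−x) + g′(−x)g(x) = c` on
`B(0,R) \ {0}`, then `c = f⁗(0)/4` (that is, `c = 6f₄`). -/
theorem stmt_17 (R : ℝ) (hR : 0 < R) (f : ℂ → ℂ)
    (hf : AnalyticOnNhd ℂ f (ball (0 : ℂ) R))
    (hf0 : f 0 = 0) (hf'0 : deriv f 0 = 1) (hf''0 : deriv (deriv f) 0 = 0)
    (hfne : ∀ x ∈ ball (0 : ℂ) R \ {0}, f x ≠ 0)
    (c : ℂ)
    (hc : ∀ x ∈ ball (0 : ℂ) R \ {0},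
      deriv (fun w => 1 / f w) x * (1 / f (-x))
        + deriv (fun w => 1 / f w) (-x) * (1 / f x) = c) :
    c = deriv (deriv (deriv (deriv f))) 0 / 4 := by
  have h0 : (0 : ℂ) ∈ ball (0 : ℂ) R := mem_ball_self hR
  obtain ⟨H, hHa, hH⟩ := (hf 0 h0).exists_eq_sum_add_pow_mul 5
  obtain ⟨K, hKa, hK⟩ := (hf 0 h0).deriv.exists_eq_sum_add_pow_mul 4
  simp only [Finset.sum_range_succ, Finset.sum_range_zero, iteratedDeriv_succ, iteratedDeriv_zero,
    hf0, hf'0, hf''0, Nat.factorial, smul_eq_mul] at hH hK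
  set d₃ := deriv (deriv (deriv f)) 0
  set d₄ := deriv (deriv (deriv (deriv f))) 0
  have hHc := hHa.continuousAt
  have hKc := hKa.continuousAt
  have hfc := (hf 0 h0).continuousAt
  have hHn : ContinuousAt H (-0) := by rwa [neg_zero]
  have hKn : ContinuousAt K (-0) := by rwa [neg_zero]
  have hfn : ContinuousAt f (-0) := by rwa [neg_zero]
  -- both sides of the identity `-(f'(x) f(-x) + f'(-x) f(x)) = c f(x)² f(-x)²`, divided by `x⁴`
  let L : ℂ → ℂ := fun x =>
    -2 * ((1 + d₃ / 2 * x ^ 2) * (d₄ / 24) - d₄ / 6 * (1 + d₃ / 6 * x ^ 2))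
      - x * ((1 + d₃ / 2 * x ^ 2 - d₄ / 6 * x ^ 3) * H x
        - (1 + d₃ / 2 * x ^ 2 + d₄ / 6 * x ^ 3) * H (-x))
      - (K x * f (-x) + K (-x) * f x)
  let M : ℂ → ℂ := fun x =>
    c * (1 + d₃ / 6 * x ^ 2 + d₄ / 24 * x ^ 3 + x ^ 4 * H x) ^ 2
      * (1 + d₃ / 6 * x ^ 2 - d₄ / 24 * x ^ 3 + x ^ 4 * H (-x)) ^ 2
  have hL : ContinuousAt L 0 := by unfold L; fun_prop
  have hM : ContinuousAt M 0 := by unfold M; fun_prop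
  have hLM : L =ᶠ[nhdsWithin 0 {0}ᶜ] M := by
    filter_upwards [self_mem_nhdsWithin, nhdsWithin_le_nhds (ball_mem_nhds (0 : ℂ) hR)]
      with x hx hxR
    have hx0 : x ≠ 0 := hx
    have hnR : -x ∈ ball (0 : ℂ) R := by simpa using hxR
    have hfx : f x ≠ 0 := hfne x ⟨hxR, hx⟩
    have hfnx : f (-x) ≠ 0 := hfne (-x) ⟨hnR, by simpa using hx0⟩
    have key := hc x ⟨hxR, hx⟩
    simp only [one_div] at key
    rw [deriv_fun_inv'' (hf x hxR).differentiableAt hfx,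
      deriv_fun_inv'' (hf _ hnR).differentiableAt hfnx] at key
    have hpoly : -(deriv f x * f (-x) + deriv f (-x) * f x) = c * f x ^ 2 * f (-x) ^ 2 := by
      rw [← key]
      field_simp
      ring
    have e₁ : x ^ 4 * L x = -(deriv f x * f (-x) + deriv f (-x) * f x) := by
      simp only [L, hK x, hK (-x)]
      rw [hH x, hH (-x)]
      push_cast
      ring
    have e₂ : x ^ 4 * M x = c * f x ^ 2 * f (-x) ^ 2 := by
      simp only [M]
      rw [hH x, hH (-x)]
      push_cast
      ring
    exact mul_left_cancel₀ (pow_ne_zero 4 hx0) (e₁.trans (hpoly.trans e₂.symm))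
  have hval : L 0 = M 0 :=
    tendsto_nhds_unique ((hL.tendsto.mono_left nhdsWithin_le_nhds).congr' hLM)
      (hM.tendsto.mono_left nhdsWithin_le_nhds)
  simp only [L, M, hf0, neg_zero] at hval
  linear_combination -hval
end
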